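/- For a partition λ of d and a fixed positive integer d, the scaled character sum ∑_{μ⊢d} g^λ_μ u^{d-ℓ(μ)} equals ∏_{w∈λ} (1 + u·c(w)), where g^λ_μ = |C_μ| χ^λ_μ / χ^λ_{(1^d)}, ℓ(μ) is the number of parts of μ, and c(w) is the content of cell w of λ. -/

import Mathlib

open MvPolynomial Finset

/-- The parts of a partition of `d`, sorted in weakly decreasing order,
as a function `ℕ → ℕ` (`0`-indexed, `0` beyond the last part). -/
def partFn {d : ℕ} (lam : Nat.Partition d) (i : ℕ) : ℕ :=
  ((lam.parts.sort (· ≤ ·)).reverse.getD i 0)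

/-- The Vandermonde product `∏_{i<j} (x_i - x_j)` in `d` variables. -/
noncomputable def vandermondePoly (d : ℕ) : MvPolynomial (Fin d) ℚ :=
  ∏ p ∈ Finset.univ.filter (fun p : Fin d × Fin d => p.1 < p.2), (X p.1 - X p.2)

/-- The irreducible character `χ^λ_μ` of the symmetric group `S_d`, defined by
the Frobenius character formula: `χ^λ_μ` is the coefficient of the monomial
`x_1^{λ_1+d-1} x_2^{λ_2+d-2} ⋯ x_d^{λ_d}` in `(∏_{i<j}(x_i-x_j)) · p_μ`,
where `p_μ = ∏_r p_{μ_r}` is the power-sum product. -/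
noncomputable def chi {d : ℕ} (lam mu : Nat.Partition d) : ℚ :=
  MvPolynomial.coeff
    (Finsupp.equivFunOnFinite.symm fun i : Fin d => partFn lam i + (d - 1 - (i : ℕ)))
    (vandermondePoly d * (mu.parts.map (fun k => psum (Fin d) ℚ k)).prod)

/-- The partition `(1^d)` of `d`. -/
def onePart (d : ℕ) : Nat.Partition d :=
  ⟨Multiset.replicate d 1, fun hi => by simp_all [Multiset.eq_of_mem_replicate hi], by simp⟩

/-- The size `|C_μ|` of the conjugacy class of `S_d` of cycle type `μ`:
the number of permutations of `{1,…,d}` whose cycle type (recording cycles of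
length at least `2`) is given by the parts of `μ` that are at least `2`. -/
noncomputable def classSize {d : ℕ} (mu : Nat.Partition d) : ℕ :=
  (Finset.univ.filter fun σ : Equiv.Perm (Fin d) =>
    σ.cycleType = mu.parts.filter (fun p => 2 ≤ p)).card

/-- The scaled character `g^λ_μ = |C_μ| χ^λ_μ / χ^λ_{(1^d)}`. -/
noncomputable def gchar {d : ℕ} (lam mu : Nat.Partition d) : ℚ :=
  (classSize mu : ℚ) * chi lam mu / chi lam (onePart d)

section CycleIndex

open Equiv Equiv.Perm

theorem Equiv.Perm.SameCycle.eq_of_comp_eq {α C : Type*} {σ : Perm α} {f : α → C}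
    (hf : ∀ x, f (σ x) = f x) {x y : α} (h : σ.SameCycle x y) : f x = f y := by
  have key : ∀ n : ℕ, ∀ x, f ((σ ^ n) x) = f x := by
    intro n
    induction n with
    | zero => simp
    | succ n ih => intro x; rw [pow_succ', Perm.mul_apply, hf, ih]
  obtain ⟨i, rfl⟩ := h
  obtain ⟨n, rfl | rfl⟩ := i.eq_nat_or_neg
  · simp [key]
  · rw [← key n ((σ ^ (-(n : ℤ))) x), ← Perm.mul_apply]
    simp

open Classical in
/-- The sizes of the cycles of a permutation are the parts of the associated partition. -/
theorem Equiv.Perm.prod_quotient_eq_prod_parts {α M : Type*} [Fintype α] [CommMonoid M]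
    (σ : Perm α) (F : ℕ → M) :
    ∏ q : Quotient (SameCycle.setoid σ),
        F (#{x | (Quotient.mk (SameCycle.setoid σ) x) = q}) =
      (σ.partition.parts.map F).prod := by
  let S := SameCycle.setoid σ
  let lift : Quotient S → Perm α := Quotient.lift σ.cycleOf fun _ _ h => SameCycle.cycleOf_eq h
  have hfib : ∀ x y : α, Quotient.mk S y = Quotient.mk S x ↔ σ.SameCycle x y := fun x y =>
    Quotient.eq.trans ⟨fun h => SameCycle.symm h, fun h => SameCycle.symm h⟩
  rw [parts_partition, Multiset.map_add, Multiset.prod_add, Multiset.map_replicate,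
    Multiset.prod_replicate, cycleType_def, Multiset.map_map,
    ← Finset.prod_filter_mul_prod_filter_not univ (fun q => lift q ∈ σ.cycleFactorsFinset)]
  congr 1
  · refine Finset.prod_bij (fun q _ => lift q) ?_ ?_ ?_ ?_
    · intro q hq
      exact (Finset.mem_filter.1 hq).2
    · intro q hq q' hq' h
      induction q using Quotient.inductionOn with | _ x
      induction q' using Quotient.inductionOn with | _ y
      have hx : x ∈ σ.support := cycleOf_mem_cycleFactorsFinset_iff.1 (Finset.mem_filter.1 hq).2
      have : x ∈ (σ.cycleOf x).support := mem_support_cycleOf_iff.2 ⟨SameCycle.refl _ _, hx⟩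
      change σ.cycleOf x = σ.cycleOf y at h
      rw [h] at this
      exact (hfib y x).2 (mem_support_cycleOf_iff.1 this).1
    · intro c hc
      obtain ⟨x, hx⟩ := (mem_cycleFactorsFinset_iff.1 hc).1.nonempty_support
      have h : c = σ.cycleOf x := cycle_is_cycleOf hx hc
      exact ⟨Quotient.mk S x, by simpa [lift, ← h] using hc, h.symm⟩
    · intro q hq
      induction q using Quotient.inductionOn with | _ x
      have hx : x ∈ σ.support := cycleOf_mem_cycleFactorsFinset_iff.1 (Finset.mem_filter.1 hq).2
      change _ = F (#(σ.cycleOf x).support)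
      congr 2
      ext y
      simp only [Finset.mem_filter, Finset.mem_univ, true_and, mem_support_cycleOf_iff, hx,
        and_true]
      exact hfib x y
  · have hcard : Fintype.card α - #σ.support = #(univ.filter fun x => x ∉ σ.support) := by
      rw [← Finset.card_compl]
      congr 1
      ext; simp
    rw [hcard, ← Finset.prod_const]
    refine (Finset.prod_bij (fun x _ => Quotient.mk S x) ?_ ?_ ?_ ?_).symm
    · intro x hx
      simp only [Finset.mem_filter, Finset.mem_univ, true_and] at hx ⊢
      exact fun h => hx (cycleOf_mem_cycleFactorsFinset_iff.1 h)
    · intro x hx y hy h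
      have hx : σ x = x := by simpa using hx
      exact ((hfib y x).1 h).symm.eq_of_left hx
    · intro q hq
      induction q using Quotient.inductionOn with | _ x
      refine ⟨x, ?_, rfl⟩
      simp only [Finset.mem_filter, Finset.mem_univ, true_and] at hq ⊢
      exact fun h => hq (cycleOf_mem_cycleFactorsFinset_iff.2 h)
    · intro x hx
      have hx : σ x = x := by simpa using hx
      congr 1
      symm
      rw [Finset.card_eq_one]
      refine ⟨x, ?_⟩
      ext y
      simp only [Finset.mem_filter, Finset.mem_univ, true_and, Finset.mem_singleton]
      rw [hfib x y]
      exact ⟨fun h => (h.eq_of_left hx).symm, fun h => h ▸ SameCycle.refl _ _⟩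

/-- The power-sum product of a permutation enumerates the colourings it fixes. -/
theorem Equiv.Perm.prod_parts_sum_pow {α C R : Type*} [Fintype α] [DecidableEq α] [Fintype C]
    [DecidableEq C] [CommSemiring R] (σ : Perm α) (w : C → R) :
    (σ.partition.parts.map fun k => ∑ c, w c ^ k).prod =
      ∑ f : α → C, if ∀ x, f (σ x) = f x then ∏ x, w (f x) else 0 := by
  classical
  let S := SameCycle.setoid σ
  have h := prod_quotient_eq_prod_parts σ fun k => ∑ c, w c ^ k
  rw [Finset.prod_univ_sum, Fintype.piFinset_univ] at h
  rw [← Finset.sum_filter]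
  refine Eq.trans ?_ (h.symm.trans (Finset.sum_bij (fun g _ => g ∘ Quotient.mk S) ?_ ?_ ?_ ?_))
  · convert rfl
  · intro g _
    simp only [Finset.mem_filter, Finset.mem_univ, true_and, Function.comp]
    exact fun x => congrArg g (Quotient.sound
      (SameCycle.symm (sameCycle_apply_right.2 (SameCycle.refl σ x))))
  · intro g _ g' _ h
    funext q
    induction q using Quotient.inductionOn with | _ x
    exact congrFun h x
  · intro f hf
    have hf := (Finset.mem_filter.1 hf).2
    exact ⟨Quotient.lift f fun _ _ h => SameCycle.eq_of_comp_eq hf h, Finset.mem_univ _, rfl⟩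
  · intro g _
    rw [← Finset.prod_fiberwise univ (Quotient.mk S)]
    refine Finset.prod_congr rfl fun q _ => ?_
    rw [Finset.prod_congr rfl (g := fun _ => w (g q))
      (fun x hx => by rw [Function.comp, (Finset.mem_filter.1 hx).2]), Finset.prod_const]

theorem Equiv.Perm.pow_card_parts {α : Type*} [Fintype α] [DecidableEq α] (σ : Perm α) (m : ℕ) :
    m ^ σ.partition.parts.card =
      ∑ f : α → Fin m, if ∀ x, f (σ x) = f x then 1 else 0 := by
  simpa using prod_parts_sum_pow σ (fun _ : Fin m => (1 : ℕ))

theorem Equiv.Perm.cons_comp_decomposeFin_symm_eq {n : ℕ} {C : Type*} (p : Fin (n + 1))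
    (τ : Perm (Fin n)) (c : C) (f : Fin n → C) :
    (∀ x, (Fin.cons c f : Fin (n + 1) → C) (decomposeFin.symm (p, τ) x) =
        (Fin.cons c f : Fin (n + 1) → C) x) ↔
      (Fin.cons c f : Fin (n + 1) → C) p = c ∧ ∀ x, f (τ x) = f x := by
  set F : Fin (n + 1) → C := Fin.cons c f with hF
  have hswap : F p = c → ∀ y, F (swap 0 p y) = F y := by
    intro h y
    rw [swap_apply_def]
    split_ifs with h1 h2
    · rw [h, h1, hF, Fin.cons_zero]
    · rw [h2, h, hF, Fin.cons_zero]
    · rfl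
  rw [Fin.forall_fin_succ]
  simp only [decomposeFin_symm_apply_zero, decomposeFin_symm_apply_succ]
  rw [show F 0 = c from rfl]
  refine and_congr_right fun h => forall_congr' fun x => ?_
  rw [hswap h]
  rfl

theorem Equiv.Perm.sum_fin_succ {n : ℕ} {M : Type*} [AddCommMonoid M]
    (G : Perm (Fin (n + 1)) → M) :
    ∑ σ, G σ = ∑ τ : Perm (Fin n), (G (decomposeFin.symm (0, τ)) +
      ∑ q : Fin n, G (decomposeFin.symm (q.succ, τ))) := by
  rw [← Equiv.sum_comp decomposeFin.symm, Fintype.sum_prod_type, Finset.sum_comm]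
  simp only [Fin.sum_univ_succ]

theorem Fin.sum_pi_succ {n : ℕ} {C M : Type*} [Fintype C] [AddCommMonoid M]
    (G : (Fin (n + 1) → C) → M) :
    ∑ g, G g = ∑ g : Fin n → C, ∑ c : C, G (Fin.cons c g) := by
  rw [← Equiv.sum_comp (Fin.consEquiv fun _ => C), Fintype.sum_prod_type, Finset.sum_comm]
  rfl

theorem Equiv.Perm.pow_card_parts_decomposeFin_symm_zero {n : ℕ} (τ : Perm (Fin n)) (m : ℕ) :
    m ^ (decomposeFin.symm (0, τ)).partition.parts.card = m * m ^ τ.partition.parts.card := by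
  classical
  simp only [pow_card_parts, Fin.sum_pi_succ, cons_comp_decomposeFin_symm_eq, Fin.cons_zero,
    true_and, Finset.sum_const, Finset.card_univ, Fintype.card_fin, smul_eq_mul, Finset.mul_sum]
  exact Finset.sum_congr rfl fun f _ => by congr

theorem Equiv.Perm.pow_card_parts_decomposeFin_symm_succ {n : ℕ} (q : Fin n) (τ : Perm (Fin n))
    (m : ℕ) :
    m ^ (decomposeFin.symm (q.succ, τ)).partition.parts.card = m ^ τ.partition.parts.card := by
  simp only [pow_card_parts, Fin.sum_pi_succ, cons_comp_decomposeFin_symm_eq, Fin.cons_succ,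
    ite_and, Finset.sum_ite_eq, Finset.mem_univ, if_true]
  exact Finset.sum_congr rfl fun f _ => by congr

/-- The cycle enumerator of the stabilizer of a colouring, a product over the colour classes. -/
theorem Equiv.Perm.sum_stabilizer_pow_card_parts {C : Type*} [Fintype C] [DecidableEq C] (m : ℕ) :
    ∀ {n : ℕ} (f : Fin n → C),
      (∑ σ : Perm (Fin n), if ∀ x, f (σ x) = f x then m ^ σ.partition.parts.card else 0) =
        ∏ c, m.ascFactorial #{x | f x = c} := by
  intro n
  induction n with
  | zero =>
    intro f
    simp [parts_partition, Finset.univ_eq_empty]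
  | succ n ih =>
    intro F
    obtain ⟨c, f, rfl⟩ : ∃ c f, F = Fin.cons c f := ⟨F 0, Fin.tail F, (Fin.cons_self_tail F).symm⟩
    have hcount : ∀ b, #{x | (Fin.cons c f : Fin (n + 1) → C) x = b} =
        #{x | f x = b} + if b = c then 1 else 0 := by
      intro b
      rw [Fin.card_filter_univ_succ]
      simp only [Fin.cons_zero, Fin.cons_succ, eq_comm (a := c)]
      split_ifs <;> rfl
    have hprod : ∏ b, m.ascFactorial #{x | (Fin.cons c f : Fin (n + 1) → C) x = b} =
        (m + #{x | f x = c}) * ∏ b, m.ascFactorial #{x | f x = b} := by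
      rw [← Finset.mul_prod_erase univ _ (Finset.mem_univ c),
        ← Finset.mul_prod_erase univ (fun b => m.ascFactorial #{x | f x = b}) (Finset.mem_univ c),
        hcount, if_pos rfl, Nat.ascFactorial_succ, mul_assoc]
      congr 2
      refine Finset.prod_congr rfl fun b hb => ?_
      rw [hcount, if_neg (Finset.ne_of_mem_erase hb), add_zero]
    rw [hprod, ← ih, sum_fin_succ, Finset.mul_sum]
    refine Finset.sum_congr rfl fun τ _ => ?_
    simp only [cons_comp_decomposeFin_symm_eq, pow_card_parts_decomposeFin_symm_zero,
      pow_card_parts_decomposeFin_symm_succ, Fin.cons_zero, Fin.cons_succ, true_and]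
    split_ifs with h
    · simp [h, Finset.sum_ite, add_mul]
    · simp [h]

theorem Equiv.Perm.sum_pow_card_parts_mul_prod_parts {C R : Type*} [Fintype C] [DecidableEq C]
    [CommSemiring R] (n m : ℕ) (w : C → R) :
    ∑ σ : Perm (Fin n), (m : R) ^ σ.partition.parts.card *
        (σ.partition.parts.map fun k => ∑ c, w c ^ k).prod =
      ∑ f : Fin n → C, (∏ c, (m.ascFactorial #{x | f x = c} : R)) * ∏ x, w (f x) := by
  simp only [prod_parts_sum_pow, Finset.mul_sum]
  rw [Finset.sum_comm]
  refine Finset.sum_congr rfl fun f _ => ?_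
  rw [← Nat.cast_prod, ← sum_stabilizer_pow_card_parts, Nat.cast_sum, Finset.sum_mul]
  refine Finset.sum_congr rfl fun σ _ => ?_
  split_ifs <;> simp

end CycleIndex

section ShiftMatrix

open scoped Nat
open Matrix

/-- The sequence `K` evaluated at `l - e`, extended by zero to negative arguments. -/
def shiftEval (K : ℕ → ℚ) (l e : ℕ) : ℚ := if e ≤ l then K (l - e) else 0

/-- The Jacobi–Trudi type matrix with entries `K (l i - (d - 1 - j))`. -/
def shiftMatrix (K : ℕ → ℚ) {d : ℕ} (l : Fin d → ℕ) : Matrix (Fin d) (Fin d) ℚ :=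
  Matrix.of fun i j => shiftEval K (l i) j.rev

theorem det_shiftMatrix_rev {K : ℕ → ℚ} (hK : K 0 = 1) (d : ℕ) :
    (shiftMatrix K fun i : Fin d => (i.rev : ℕ)).det = 1 := by
  rw [Matrix.det_of_isUpperTriangular]
  · simp [shiftMatrix, shiftEval, hK]
  · intro i j hij
    have hij : j < i := hij
    have : ¬ ((j.rev : ℕ) ≤ i.rev) := not_le.2 (Fin.rev_lt_rev.2 hij)
    simp only [shiftMatrix, shiftEval, Matrix.of_apply, if_neg this]

theorem exists_det_shiftMatrix_eq {K : ℕ → ℚ} {d : ℕ} (w : ℕ → ℚ) (Q : ℕ → Polynomial ℚ)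
    (hdeg : ∀ e < d, (Q e).natDegree < d)
    (hK : ∀ e < d, ∀ l, shiftEval K l e = w l * (Q e).eval (l : ℚ)) :
    ∃ c : ℚ, ∀ l : Fin d → ℕ, (shiftMatrix K l).det =
      (∏ i, w (l i)) * ((vandermonde fun i => (l i : ℚ)).det * c) := by
  refine ⟨(Matrix.of fun k j : Fin d => (Q j.rev).coeff k).det, fun l => ?_⟩
  rw [← Matrix.det_mul, ← Matrix.det_mul_column]
  congr 1
  ext i j
  simp only [shiftMatrix, Matrix.of_apply, Matrix.mul_apply, vandermonde_apply]
  rw [hK _ j.rev.isLt, Polynomial.eval_eq_sum_range' (hdeg _ j.rev.isLt), Finset.sum_range]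
  simp only [mul_comm]

theorem det_shiftMatrix_mul {K : ℕ → ℚ} {d : ℕ} (w : ℕ → ℚ) (Q : ℕ → Polynomial ℚ)
    (hdeg : ∀ e < d, (Q e).natDegree < d)
    (hK : ∀ e < d, ∀ l, shiftEval K l e = w l * (Q e).eval (l : ℚ)) (hK0 : K 0 = 1)
    (l : Fin d → ℕ) :
    (shiftMatrix K l).det *
        ((∏ i : Fin d, w i.rev) * (vandermonde fun i : Fin d => ((i.rev : ℕ) : ℚ)).det) =
      (∏ i, w (l i)) * (vandermonde fun i => (l i : ℚ)).det := by
  obtain ⟨c, hc⟩ := exists_det_shiftMatrix_eq w Q hdeg hK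
  have h := hc fun i => i.rev
  rw [det_shiftMatrix_rev hK0] at h
  rw [hc l]
  linear_combination -(∏ i, w (l i)) * (vandermonde fun i => (l i : ℚ)).det * h

theorem shiftEval_inv_factorial (l e : ℕ) :
    shiftEval (fun k => 1 / (k ! : ℚ)) l e =
      1 / (l ! : ℚ) * (descPochhammer ℚ e).eval (l : ℚ) := by
  rw [descPochhammer_eval_eq_descFactorial, shiftEval]
  split_ifs with h
  · rw [← Nat.factorial_mul_descFactorial h]
    have := Nat.factorial_ne_zero (l - e)
    have := (Nat.descFactorial_pos.2 h).ne'
    push_cast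
    field_simp
  · rw [Nat.descFactorial_of_lt (not_le.1 h)]
    simp

theorem factorial_sub_mul_prod_range (N t : ℕ) (ht : t ≤ N) :
    (((N - t)! : ℕ) : ℚ) * ∏ s ∈ Finset.range t, ((N : ℚ) - s) = N ! := by
  rw [← descPochhammer_eval_eq_prod_range, descPochhammer_eval_eq_descFactorial]
  exact_mod_cast Nat.factorial_mul_descFactorial ht

theorem shiftEval_ascFactorial {d m : ℕ} (hm : d ≤ m) {e : ℕ} (he : e < d) (l : ℕ) :
    shiftEval (fun k => (m.ascFactorial k : ℚ) / k !) l e =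
      ((m + l - d)! : ℚ) / (l ! * (m - 1)!) * (descPochhammer ℚ e *
        ∏ s ∈ Finset.range (d - 1 - e),
          (Polynomial.X + Polynomial.C ((m : ℚ) - (e + 1) - s))).eval (l : ℚ) := by
  rw [Polynomial.eval_mul, descPochhammer_eval_eq_descFactorial, shiftEval]
  split_ifs with h
  · obtain ⟨n, rfl⟩ : ∃ n, m = n + 1 := ⟨m - 1, by omega⟩
    have h1 := factorial_sub_mul_prod_range (n + l - e) (d - 1 - e) (by omega)
    have h2 : n + l - e - (d - 1 - e) = n + 1 + l - d := by omega
    have h3 : (((n + l - e : ℕ) : ℚ)) = n + l - e := by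
      rw [Nat.cast_sub (by omega)]; push_cast; ring
    have h4 : ∏ s ∈ Finset.range (d - 1 - e), ((l : ℚ) + (((n + 1 : ℕ) : ℚ) - (e + 1) - s)) =
        ∏ s ∈ Finset.range (d - 1 - e), (((n + l - e : ℕ) : ℚ) - s) :=
      Finset.prod_congr rfl fun s _ => by rw [h3]; push_cast; ring
    have h5 := Nat.factorial_mul_ascFactorial n (l - e)
    have h6 : n + (l - e) = n + l - e := by omega
    have h7 := Nat.factorial_mul_descFactorial h
    rw [h6] at h5
    rw [h2] at h1
    rw [Polynomial.eval_prod]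
    simp only [Polynomial.eval_add, Polynomial.eval_X, Polynomial.eval_C]
    rw [h4, add_tsub_cancel_right, ← h7]
    have := Nat.factorial_ne_zero (l - e)
    have := (Nat.descFactorial_pos.2 h).ne'
    have := Nat.factorial_ne_zero n
    have h5' : (n ! : ℚ) * ((n + 1).ascFactorial (l - e) : ℚ) = (n + l - e)! := by
      exact_mod_cast h5
    push_cast
    field_simp
    linear_combination h5' - h1
  · rw [Nat.descFactorial_of_lt (not_le.1 h)]
    simp

theorem det_shiftMatrix_inv_factorial {d : ℕ} (l : Fin d → ℕ) :
    (shiftMatrix (fun k => 1 / (k ! : ℚ)) l).det * ((∏ i : Fin d, 1 / ((i.rev : ℕ)! : ℚ)) *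
        (vandermonde fun i : Fin d => ((i.rev : ℕ) : ℚ)).det) =
      (∏ i, 1 / ((l i)! : ℚ)) * (vandermonde fun i => (l i : ℚ)).det :=
  det_shiftMatrix_mul (fun n => 1 / (n ! : ℚ)) (descPochhammer ℚ)
    (fun e he => by rwa [descPochhammer_natDegree]) (fun e _ l => shiftEval_inv_factorial l e)
    (by simp) l

theorem det_shiftMatrix_ascFactorial {d m : ℕ} (hm : d ≤ m) (l : Fin d → ℕ) :
    (shiftMatrix (fun k => (m.ascFactorial k : ℚ) / k !) l).det *
        ((∏ i : Fin d, ((m + i.rev - d)! : ℚ) / ((i.rev : ℕ)! * (m - 1)!)) *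
          (vandermonde fun i : Fin d => ((i.rev : ℕ) : ℚ)).det) =
      (∏ i, ((m + l i - d)! : ℚ) / ((l i)! * (m - 1)!)) *
        (vandermonde fun i => (l i : ℚ)).det := by
  refine det_shiftMatrix_mul (fun n => ((m + n - d)! : ℚ) / (n ! * (m - 1)!)) _ ?_
    (fun e he l => shiftEval_ascFactorial hm he l) (by simp) l
  intro e he
  refine lt_of_le_of_lt Polynomial.natDegree_mul_le ?_
  rw [descPochhammer_natDegree]
  have : (∏ s ∈ Finset.range (d - 1 - e), (Polynomial.X +
      Polynomial.C ((m : ℚ) - (e + 1) - s))).natDegree ≤ ∑ s ∈ Finset.range (d - 1 - e), 1 :=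
    (Polynomial.natDegree_prod_le _ _).trans
      (Finset.sum_le_sum fun s _ => (Polynomial.natDegree_X_add_C _).le)
  simp only [Finset.sum_const, Finset.card_range, smul_eq_mul, mul_one] at this
  omega

theorem det_vandermonde_rev_ne_zero (d : ℕ) :
    (vandermonde fun i : Fin d => ((i.rev : ℕ) : ℚ)).det ≠ 0 := by
  rw [det_vandermonde_ne_zero_iff]
  exact fun i j h => Fin.rev_injective (Fin.ext (Nat.cast_injective h))

theorem det_shiftMatrix_inv_factorial_ne_zero {d : ℕ} {l : Fin d → ℕ}
    (hl : Function.Injective l) : (shiftMatrix (fun k => 1 / (k ! : ℚ)) l).det ≠ 0 := by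
  have h : (vandermonde fun i => (l i : ℚ)).det ≠ 0 :=
    det_vandermonde_ne_zero_iff.2 fun i j h => hl (by exact_mod_cast h)
  intro h0
  have h1 := det_shiftMatrix_inv_factorial l
  rw [h0, zero_mul] at h1
  refine mul_ne_zero (Finset.prod_ne_zero_iff.2 fun i _ => ?_) h h1.symm
  exact one_div_ne_zero (by exact_mod_cast Nat.factorial_ne_zero _)

theorem det_shiftMatrix_ascFactorial_eq {d m : ℕ} (hm : d ≤ m) (l : Fin d → ℕ) :
    (shiftMatrix (fun k => (m.ascFactorial k : ℚ) / k !) l).det =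
      (shiftMatrix (fun k => 1 / (k ! : ℚ)) l).det *
        ∏ i, ((m + l i - d)! : ℚ) / (m + i.rev - d)! := by
  have hV := det_vandermonde_rev_ne_zero d
  have h1 := det_shiftMatrix_inv_factorial l
  have h2 := det_shiftMatrix_ascFactorial hm l
  have hf : ∀ n : ℕ, (n ! : ℚ) ≠ 0 := fun n => by exact_mod_cast Nat.factorial_ne_zero n
  have hp : ∀ f : Fin d → ℕ, ∏ i, ((f i)! : ℚ) ≠ 0 := fun f =>
    Finset.prod_ne_zero_iff.2 fun i _ => hf _
  simp only [Finset.prod_div_distrib, Finset.prod_mul_distrib, Finset.prod_const_one] at h1 h2 ⊢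
  have hm1 : ∏ _i : Fin d, ((m - 1)! : ℚ) ≠ 0 := hp fun _ => m - 1
  have a1 := hp fun i => i.rev
  have a2 := hp l
  have a3 := hp fun i => m + i.rev - d
  refine mul_right_cancel₀ (b := (∏ i : Fin d, ((m + i.rev - d)! : ℚ)) /
    ((∏ i : Fin d, ((i.rev : ℕ)! : ℚ)) * ∏ _i : Fin d, ((m - 1)! : ℚ)) *
    (vandermonde fun i : Fin d => ((i.rev : ℕ) : ℚ)).det)
    (mul_ne_zero (div_ne_zero a3 (mul_ne_zero a1 hm1)) hV) ?_
  rw [h2]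
  field_simp at h1 ⊢
  linear_combination -h1

end ShiftMatrix

section Coefficients

open scoped Nat

/-- The number of times a colouring uses each colour. -/
def colorCount {n : ℕ} {C : Type*} [DecidableEq C] (f : Fin n → C) (c : C) : ℕ :=
  #{x | f x = c}

theorem prod_X_eq_monomial_colorCount {n : ℕ} {C : Type*} [Fintype C] [DecidableEq C]
    (f : Fin n → C) :
    ∏ x, (X (f x) : MvPolynomial C ℚ) =
      monomial (Finsupp.equivFunOnFinite.symm (colorCount f)) 1 := by
  rw [← Finset.prod_fiberwise univ f, monomial_eq, C_1, one_mul, Finsupp.prod_fintype _ _ (by simp)]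
  refine Finset.prod_congr rfl fun c _ => ?_
  rw [Finset.prod_congr rfl (g := fun _ => X c)
    (fun x hx => by rw [(Finset.mem_filter.1 hx).2]), Finset.prod_const]
  rfl

theorem sum_X_pow_eq_sum_prod {n : ℕ} {C : Type*} [Fintype C] :
    (∑ c, (X c : MvPolynomial C ℚ)) ^ n = ∑ f : Fin n → C, ∏ x, X (f x) := by
  rw [Fintype.sum_pow]

theorem card_colorCount_eq {n : ℕ} {C : Type*} [Fintype C] [DecidableEq C] (β : C → ℕ)
    (hβ : ∑ c, β c = n) :
    #{f : Fin n → C | colorCount f = β} = Nat.multinomial univ β := by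
  have h : coeff (Finsupp.equivFunOnFinite.symm β) ((∑ c, (X c : MvPolynomial C ℚ)) ^ n) =
      #{f : Fin n → C | colorCount f = β} := by
    rw [sum_X_pow_eq_sum_prod, coeff_sum]
    simp only [prod_X_eq_monomial_colorCount, coeff_monomial, EmbeddingLike.apply_eq_iff_eq]
    simp
  have h' : coeff (Finsupp.equivFunOnFinite.symm β) ((∑ c, (X c : MvPolynomial C ℚ)) ^ n) =
      Nat.multinomial univ β := by
    rw [Finset.sum_pow_eq_sum_piAntidiag, coeff_sum]
    have hm : ∀ k : C → ℕ, (Nat.multinomial univ k : MvPolynomial C ℚ) * ∏ i, X i ^ k i =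
        monomial (Finsupp.equivFunOnFinite.symm k) (Nat.multinomial univ k : ℚ) := by
      intro k
      rw [monomial_eq, Finsupp.prod_fintype _ _ (by simp), map_natCast]
      rfl
    simp only [hm, coeff_monomial, EmbeddingLike.apply_eq_iff_eq]
    rw [Finset.sum_ite_eq', if_pos (by simp [hβ])]
  exact_mod_cast h.symm.trans h'

/-- The polynomial `∑ f, ∏ c, w (colorCount f c) * x_c ^ colorCount f c`. -/
noncomputable def colorPoly (n : ℕ) {C : Type*} [Fintype C] [DecidableEq C] (w : ℕ → ℚ) :
    MvPolynomial C ℚ :=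
  ∑ f : Fin n → C, MvPolynomial.C (∏ c, w (colorCount f c)) * ∏ x, X (f x)

theorem coeff_colorPoly {n : ℕ} {C : Type*} [Fintype C] [DecidableEq C] (K : ℕ → ℚ)
    (β : C →₀ ℕ) (hβ : ∑ c, β c = n) :
    coeff β (colorPoly n fun k => k ! * K k) = n ! * ∏ c, K (β c) := by
  have hterm : ∀ f : Fin n → C, coeff β (MvPolynomial.C (∏ c, (colorCount f c)! *
      K (colorCount f c)) * ∏ x, X (f x)) =
      if colorCount f = β then ∏ c, ((β c)! * K (β c)) else 0 := by
    intro f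
    rw [prod_X_eq_monomial_colorCount, coeff_C_mul, coeff_monomial]
    have : Finsupp.equivFunOnFinite.symm (colorCount f) = β ↔ colorCount f = β := by
      rw [Equiv.symm_apply_eq]; rfl
    simp only [this]
    split_ifs with h
    · rw [h, mul_one]
    · rw [mul_zero]
  rw [colorPoly, coeff_sum, Finset.sum_congr rfl fun f _ => hterm f, ← Finset.sum_filter,
    Finset.sum_const, card_colorCount_eq _ hβ, nsmul_eq_mul, Finset.prod_mul_distrib, ← hβ,
    ← Nat.multinomial_spec]
  push_cast
  ring

theorem vandermondePoly_eq_det (d : ℕ) :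
    vandermondePoly d =
      (Matrix.of fun i j : Fin d => (X i : MvPolynomial (Fin d) ℚ) ^ (j.rev : ℕ)).det := by
  have h := Matrix.det_projVandermonde (fun _ : Fin d => (1 : MvPolynomial (Fin d) ℚ)) X
  have h' : Matrix.projVandermonde (fun _ : Fin d => (1 : MvPolynomial (Fin d) ℚ)) X =
      Matrix.of fun i j : Fin d => (X i : MvPolynomial (Fin d) ℚ) ^ (j.rev : ℕ) := by
    ext1 i j
    simp [Matrix.projVandermonde_apply]
  rw [← h', h, vandermondePoly, Finset.prod_filter, Fintype.prod_prod_type]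
  refine Finset.prod_congr rfl fun i _ => ?_
  rw [← Finset.prod_filter]
  refine Finset.prod_congr (by ext; simp) fun j _ => by ring

theorem coeff_vandermondePoly_mul_colorPoly {d : ℕ} (K : ℕ → ℚ) (l : Fin d → ℕ)
    (hl : ∑ i, l i = d + ∑ i : Fin d, (i.rev : ℕ)) :
    coeff (Finsupp.equivFunOnFinite.symm l)
        (vandermondePoly d * colorPoly d fun k => k ! * K k) =
      d ! * (shiftMatrix K l).det := by
  rw [vandermondePoly_eq_det, ← Matrix.det_transpose, ← (shiftMatrix K l).det_transpose,
    Matrix.det_apply', Matrix.det_apply', Finset.sum_mul, coeff_sum, Finset.mul_sum]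
  refine Finset.sum_congr rfl fun π _ => ?_
  have hmon : ∏ i, (Matrix.of fun i j : Fin d =>
      (X i : MvPolynomial (Fin d) ℚ) ^ (j.rev : ℕ)).transpose (π i) i =
      monomial (Finsupp.equivFunOnFinite.symm fun i => ((π i).rev : ℕ)) 1 := by
    rw [monomial_eq, Finsupp.prod_fintype _ _ (by simp), C_1, one_mul]
    rfl
  rw [hmon, mul_assoc, ← map_intCast (MvPolynomial.C : ℚ →+* MvPolynomial (Fin d) ℚ),
    coeff_C_mul, coeff_monomial_mul', one_mul]
  rw [mul_left_comm]
  congr 1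
  have hle : (Finsupp.equivFunOnFinite.symm fun i => ((π i).rev : ℕ)) ≤
      Finsupp.equivFunOnFinite.symm l ↔ ∀ i, ((π i).rev : ℕ) ≤ l i := Iff.rfl
  split_ifs with h
  · rw [hle] at h
    rw [coeff_colorPoly]
    · congr 1
      refine Finset.prod_congr rfl fun i _ => ?_
      simp only [shiftMatrix, shiftEval, Matrix.transpose_apply, Matrix.of_apply, if_pos (h i)]
      rfl
    · change ∑ i, (l i - ((π i).rev : ℕ)) = d
      rw [Finset.sum_tsub_distrib _ fun i _ => h i, hl,
        Equiv.sum_comp π fun i => (i.rev : ℕ), add_tsub_cancel_right]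
  · rw [hle] at h
    push Not at h
    obtain ⟨i, hi⟩ := h
    rw [Finset.prod_eq_zero (Finset.mem_univ i), mul_zero]
    simp only [shiftMatrix, shiftEval, Matrix.transpose_apply, Matrix.of_apply,
      if_neg (not_le.2 hi)]

end Coefficients

section Partitions

theorem Nat.Partition.ext_of_filter_two_le {n : ℕ} {p q : Nat.Partition n}
    (h : p.parts.filter (2 ≤ ·) = q.parts.filter (2 ≤ ·)) : p = q := by
  have key : ∀ r : Nat.Partition n, r.parts = r.parts.filter (2 ≤ ·) +
      Multiset.replicate (n - (r.parts.filter (2 ≤ ·)).sum) 1 := by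
    intro r
    have h1 : r.parts.filter (fun x => ¬ 2 ≤ x) =
        Multiset.replicate (r.parts.filter (fun x => ¬ 2 ≤ x)).card 1 := by
      refine Multiset.eq_replicate_card.2 fun b hb => ?_
      have := r.parts_pos (Multiset.mem_of_mem_filter hb)
      have := (Multiset.mem_filter.1 hb).2
      omega
    have h2 := Multiset.filter_add_not (2 ≤ ·) r.parts
    have h3 := congrArg Multiset.sum h2
    rw [Multiset.sum_add, r.parts_sum, h1, Multiset.sum_replicate] at h3
    conv_lhs => rw [← h2, h1]
    congr 2
    simp at h3 ⊢
    omega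
  exact Nat.Partition.ext (by rw [key p, key q, h])

/-- The cycle type of a permutation of `Fin d`, as a partition of `d`. -/
def cyclePartition {d : ℕ} (σ : Equiv.Perm (Fin d)) : Nat.Partition d :=
  ⟨σ.partition.parts, fun h => σ.partition.parts_pos h, by
    rw [σ.partition.parts_sum, Fintype.card_fin]⟩

theorem cyclePartition_eq_iff {d : ℕ} (σ : Equiv.Perm (Fin d)) (mu : Nat.Partition d) :
    cyclePartition σ = mu ↔ σ.cycleType = mu.parts.filter (fun p => 2 ≤ p) := by
  rw [← Equiv.Perm.filter_parts_partition_eq_cycleType]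
  exact ⟨fun h => h ▸ rfl, fun h => Nat.Partition.ext_of_filter_two_le h⟩

theorem sum_classSize_mul {d : ℕ} (G : Nat.Partition d → ℚ) :
    ∑ mu, (classSize mu : ℚ) * G mu = ∑ σ : Equiv.Perm (Fin d), G (cyclePartition σ) := by
  rw [← Finset.sum_fiberwise univ cyclePartition]
  refine Finset.sum_congr rfl fun mu _ => ?_
  rw [Finset.sum_congr rfl (g := fun _ => G mu)
    (fun x hx => by rw [(Finset.mem_filter.1 hx).2]), Finset.sum_const, nsmul_eq_mul, classSize]
  simp only [cyclePartition_eq_iff]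

theorem partFn_antitone {d : ℕ} (lam : Nat.Partition d) : Antitone (partFn lam) := by
  have hp : (lam.parts.sort (· ≤ ·)).reverse.Pairwise (· ≥ ·) :=
    List.pairwise_reverse.2 (Multiset.pairwise_sort _ _)
  intro i j hij
  unfold partFn
  set L := (lam.parts.sort (· ≤ ·)).reverse
  by_cases hj : j < L.length
  · rw [List.getD_eq_getElem _ _ hj, List.getD_eq_getElem _ _ (hij.trans_lt hj)]
    rcases hij.eq_or_lt with rfl | h
    · rfl
    · exact List.pairwise_iff_getElem.1 hp i j _ hj h
  · rw [List.getD_eq_default _ _ (not_lt.1 hj)]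
    exact Nat.zero_le _

theorem partFn_eq_zero {d : ℕ} (lam : Nat.Partition d) {i : ℕ} (hi : lam.parts.card ≤ i) :
    partFn lam i = 0 := by
  rw [partFn, List.getD_eq_default]
  simpa using hi

theorem Nat.Partition.card_parts_le {d : ℕ} (lam : Nat.Partition d) : lam.parts.card ≤ d := by
  have := Multiset.card_nsmul_le_sum (s := lam.parts) (a := 1) fun x hx => lam.parts_pos hx
  rwa [lam.parts_sum, smul_eq_mul, mul_one] at this

theorem sum_partFn {d : ℕ} (lam : Nat.Partition d) : ∑ i : Fin d, partFn lam i = d := by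
  rw [← Finset.sum_range (partFn lam),
    ← Finset.sum_subset (Finset.range_subset_range.2 lam.card_parts_le)
      fun i _ hi => partFn_eq_zero lam (by simpa using hi)]
  have hlen : lam.parts.card = (lam.parts.sort (· ≤ ·)).reverse.length := by simp
  conv_rhs => rw [← lam.parts_sum, ← Multiset.sort_eq lam.parts (· ≤ ·), Multiset.sum_coe,
    ← List.sum_reverse]
  rw [hlen, Finset.sum_range, ← Fin.sum_univ_getElem]
  exact Finset.sum_congr rfl fun i _ => List.getD_eq_getElem _ _ i.isLt

end Partitions

section ContentProduct

open scoped Nat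

theorem chi_eq_coeff {d : ℕ} (lam mu : Nat.Partition d) :
    chi lam mu = coeff (Finsupp.equivFunOnFinite.symm fun i : Fin d => partFn lam i + i.rev)
      (vandermondePoly d * (mu.parts.map (fun k => psum (Fin d) ℚ k)).prod) := by
  have : (fun i : Fin d => partFn lam i + (d - 1 - (i : ℕ))) =
      fun i : Fin d => partFn lam i + (i.rev : ℕ) := by
    funext i
    rw [Fin.val_rev, Nat.sub_sub, add_comm 1]
  rw [chi, this]

theorem sum_partFn_add_rev {d : ℕ} (lam : Nat.Partition d) :
    ∑ i : Fin d, (partFn lam i + (i.rev : ℕ)) = d + ∑ i : Fin d, (i.rev : ℕ) := by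
  rw [Finset.sum_add_distrib, sum_partFn]

theorem partFn_add_rev_injective {d : ℕ} (lam : Nat.Partition d) :
    Function.Injective fun i : Fin d => partFn lam i + (i.rev : ℕ) := by
  have : StrictAnti fun i : Fin d => partFn lam i + (i.rev : ℕ) := fun i j h =>
    add_lt_add_of_le_of_lt (partFn_antitone lam h.le) (Fin.rev_lt_rev.2 h)
  exact this.injective

theorem chi_onePart {d : ℕ} (lam : Nat.Partition d) :
    chi lam (onePart d) = d ! * (shiftMatrix (fun k => 1 / (k ! : ℚ))
      fun i : Fin d => partFn lam i + (i.rev : ℕ)).det := by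
  rw [chi_eq_coeff, ← coeff_vandermondePoly_mul_colorPoly _ _ (sum_partFn_add_rev lam)]
  congr 2
  have h : ∀ k : ℕ, (k ! : ℚ) * (1 / k !) = 1 := fun k =>
    mul_one_div_cancel (by exact_mod_cast k.factorial_ne_zero)
  simp only [colorPoly, h, Finset.prod_const_one, C_1, one_mul, ← sum_X_pow_eq_sum_prod]
  simp [onePart, psum]

theorem sum_classSize_mul_chi {d : ℕ} (lam : Nat.Partition d) (m : ℕ) :
    ∑ mu : Nat.Partition d, (classSize mu : ℚ) * ((m : ℚ) ^ mu.parts.card * chi lam mu) =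
      d ! * (shiftMatrix (fun k => (m.ascFactorial k : ℚ) / k !)
        fun i : Fin d => partFn lam i + (i.rev : ℕ)).det := by
  rw [sum_classSize_mul fun mu => (m : ℚ) ^ mu.parts.card * chi lam mu,
    ← coeff_vandermondePoly_mul_colorPoly _ _ (sum_partFn_add_rev lam)]
  have h : ∀ k : ℕ, (k ! : ℚ) * ((m.ascFactorial k : ℚ) / k !) = m.ascFactorial k := fun k =>
    mul_div_cancel₀ _ (by exact_mod_cast k.factorial_ne_zero)
  have hpoly : (colorPoly d fun k => (m.ascFactorial k : ℚ) : MvPolynomial (Fin d) ℚ) =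
      ∑ σ : Equiv.Perm (Fin d), MvPolynomial.C ((m : ℚ) ^ (cyclePartition σ).parts.card) *
        ((cyclePartition σ).parts.map fun k => psum (Fin d) ℚ k).prod := by
    have := Equiv.Perm.sum_pow_card_parts_mul_prod_parts d m
      (X : Fin d → MvPolynomial (Fin d) ℚ)
    simp only [colorPoly, map_prod, map_natCast, map_pow]
    exact this.symm
  simp only [h, hpoly, chi_eq_coeff, Finset.mul_sum, coeff_sum]
  refine Finset.sum_congr rfl fun σ _ => ?_
  rw [mul_left_comm, coeff_C_mul]

theorem sum_gchar_mul_pow {d m : ℕ} (hm : d ≤ m) (lam : Nat.Partition d) :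
    ∑ mu : Nat.Partition d, gchar lam mu * (m : ℚ) ^ mu.parts.card =
      ∏ i : Fin d, ∏ j ∈ Finset.range (partFn lam i), ((m : ℚ) + ((j : ℚ) - (i : ℕ))) := by
  have h1 : chi lam (onePart d) ≠ 0 := by
    rw [chi_onePart]
    exact mul_ne_zero (by exact_mod_cast d.factorial_ne_zero)
      (det_shiftMatrix_inv_factorial_ne_zero (partFn_add_rev_injective lam))
  have h2 := sum_classSize_mul_chi lam m
  rw [det_shiftMatrix_ascFactorial_eq hm, ← mul_assoc, ← chi_onePart] at h2
  have h3 : ∑ mu : Nat.Partition d, gchar lam mu * (m : ℚ) ^ mu.parts.card =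
      (∑ mu : Nat.Partition d, (classSize mu : ℚ) * ((m : ℚ) ^ mu.parts.card * chi lam mu)) /
        chi lam (onePart d) := by
    rw [Finset.sum_div]
    exact Finset.sum_congr rfl fun mu _ => by rw [gchar]; ring
  rw [h3, h2, mul_div_cancel_left₀ _ h1]
  refine Finset.prod_congr rfl fun i _ => ?_
  have hi := i.isLt
  rw [Fin.val_rev]
  have e1 : m + (d - (i + 1)) - d = m - (i + 1) := by omega
  have e2 : m + (partFn lam i + (d - (i + 1))) - d = m - (i + 1) + partFn lam i := by omega
  rw [e1, e2, ← Nat.factorial_mul_ascFactorial, Nat.cast_mul, mul_div_cancel_left₀ _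
    (by exact_mod_cast Nat.factorial_ne_zero _), Nat.ascFactorial_eq_prod_range, Nat.cast_prod]
  refine Finset.prod_congr rfl fun j _ => ?_
  have : m - (i + 1) + 1 = m - i := by omega
  rw [this, Nat.cast_add, Nat.cast_sub (by omega)]
  ring

theorem sum_gchar_mul_inv_pow {d m : ℕ} (hd : 1 ≤ d) (hm : d ≤ m) (lam : Nat.Partition d) :
    ∑ mu : Nat.Partition d, gchar lam mu * (1 / (m : ℚ)) ^ (d - mu.parts.card) =
      ∏ i ∈ Finset.range lam.parts.card, ∏ j ∈ Finset.range (partFn lam i),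
        (1 + 1 / (m : ℚ) * ((j : ℚ) - (i : ℚ))) := by
  have hm0 : (m : ℚ) ≠ 0 := by exact_mod_cast (show m ≠ 0 by omega)
  refine mul_left_cancel₀ (pow_ne_zero d hm0) ?_
  rw [Finset.prod_subset (Finset.range_subset_range.2 lam.card_parts_le) fun i _ hi => by
    rw [partFn_eq_zero lam (by simpa using hi), Finset.range_zero, Finset.prod_empty]]
  have hpow : (m : ℚ) ^ d = ∏ i : Fin d, ∏ j ∈ Finset.range (partFn lam i), (m : ℚ) := by
    simp only [Finset.prod_const, Finset.card_range, Finset.prod_pow_eq_pow_sum, sum_partFn]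
  conv_rhs => rw [hpow, Finset.prod_range, ← Finset.prod_mul_distrib]
  simp only [← Finset.prod_mul_distrib]
  rw [Finset.mul_sum]
  refine Eq.trans (Finset.sum_congr rfl fun mu _ => ?_) ((sum_gchar_mul_pow hm lam).trans
    (Finset.prod_congr rfl fun i _ => Finset.prod_congr rfl fun j _ => ?_))
  · rw [one_div, inv_pow, pow_sub₀ _ hm0 mu.card_parts_le]
    field_simp
  · field_simp

end ContentProduct

/-- For a partition `λ` of `d ≥ 1` and a variable `u`,
`∑_{μ⊢d} g^λ_μ u^{d-ℓ(μ)} = ∏_{w∈λ} (1 + u·c(w))`, where `g^λ_μ =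
|C_μ| χ^λ_μ / χ^λ_{(1^d)}`, `ℓ(μ)` is the number of parts of `μ`, and the
product is over the cells `(i,j)` of `λ` with content `j - i`
(here `0`-indexed). -/
theorem stmt7 (d : ℕ) (hd : 1 ≤ d) (lam : Nat.Partition d) (u : ℚ) :
    ∑ mu : Nat.Partition d, gchar lam mu * u ^ (d - mu.parts.card) =
      ∏ i ∈ Finset.range lam.parts.card, ∏ j ∈ Finset.range (partFn lam i),
        (1 + u * ((j : ℚ) - (i : ℚ))) := by
  let P : Polynomial ℚ := ∑ mu : Nat.Partition d,
    Polynomial.C (gchar lam mu) * Polynomial.X ^ (d - mu.parts.card)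
  let Q : Polynomial ℚ := ∏ i ∈ Finset.range lam.parts.card, ∏ j ∈ Finset.range (partFn lam i),
    (1 + Polynomial.X * Polynomial.C ((j : ℚ) - (i : ℚ)))
  have hP : ∀ v : ℚ, P.eval v =
      ∑ mu : Nat.Partition d, gchar lam mu * v ^ (d - mu.parts.card) := fun v => by
    simp [P, Polynomial.eval_finsetSum]
  have hQ : ∀ v : ℚ, Q.eval v = ∏ i ∈ Finset.range lam.parts.card,
      ∏ j ∈ Finset.range (partFn lam i), (1 + v * ((j : ℚ) - (i : ℚ))) := fun v => by
    simp [Q, Polynomial.eval_prod]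
  have hPQ : P = Q := by
    refine Polynomial.eq_of_infinite_eval_eq P Q
      (Set.infinite_of_injective_forall_mem (f := fun n : ℕ => 1 / ((n + d : ℕ) : ℚ)) ?_ ?_)
    · intro a b h
      simpa using h
    · intro n
      rw [Set.mem_ofPred_eq, hP, hQ]
      exact sum_gchar_mul_inv_pow hd (Nat.le_add_left d n) lam
  rw [← hP, ← hQ, hPQ]
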